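/- Let T be a tight tour for the HCPP instance I_φ=(G,ω,𝒫,≺) produced by the construction from a 3-CNF formula φ, and let M = E(T) \ E. Then for each i∈{1,…,n}, either the edge {t_i^{6ℓ−3},t_i^{6ℓ−2}} is covered for all ℓ∈{1,…,μ_i}, or the edge {f_i^{6ℓ−3},f_i^{6ℓ−2}} is covered for all ℓ∈{1,…,μ_i} (and not both). -/

import Mathlib

namespace HCPPFormal

variable {V : Type} [DecidableEq V]

/-- The degree of a vertex in a multigraph given as a multiset of edges
(loops count twice, multiplicities are counted). -/
def mDeg (M : Multiset (Sym2 V)) (v : V) : ℕ :=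
  (M.map fun e => if e = Sym2.diag v then 2 else if v ∈ e then 1 else 0).sum

/-- The vertex set of the multigraph induced by a multiset of edges. -/
def mVerts (M : Multiset (Sym2 V)) : Set V := {v | ∃ e ∈ M, v ∈ e}

/-- Adjacency in the multigraph induced by a multiset of edges. -/
def mAdj (M : Multiset (Sym2 V)) (a b : V) : Prop := s(a, b) ∈ M

/-- The multigraph induced by a multiset of edges is connected. -/
def mConnected (M : Multiset (Sym2 V)) : Prop :=
  ∀ u ∈ mVerts M, ∀ v ∈ mVerts M, Relation.ReflTransGen (mAdj M) u v

/-- The list of edges traversed by a walk, given as its list of vertices. -/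
def walkEdgeList (w : List V) : List (Sym2 V) :=
  (w.zip w.tail).map fun p => s(p.1, p.2)

/-- The multiset of edges traversed by a walk (with multiplicities). -/
def walkEdges (w : List V) : Multiset (Sym2 V) :=
  (walkEdgeList w : Multiset (Sym2 V))

/-- The weight of a multiset of edges. -/
def mWeight (ω : Sym2 V → ℕ) (M : Multiset (Sym2 V)) : ℕ := (M.map ω).sum

/-- The weight of a walk. -/
def wWeight (ω : Sym2 V → ℕ) (w : List V) : ℕ := mWeight ω (walkEdges w)

/-- A multiset `M` of edges is a perfect matching on the vertex set `U`:
it is a set of pairwise vertex-disjoint non-loop edges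
whose endpoints are exactly the vertices of `U`. -/
def IsPerfectMatchingOn (M : Multiset (Sym2 V)) (U : Set V) : Prop :=
  M.Nodup ∧ (∀ e ∈ M, ¬ e.IsDiag) ∧
  (∀ e ∈ M, ∀ e' ∈ M, e ≠ e' → ∀ v : V, v ∈ e → v ∉ e') ∧
  mVerts M = U



/-- Vertices of the graph constructed from a 3-CNF formula:
`t i l`, `z i l`, `f i l` are the vertices `t_i^ℓ`, `z_i^ℓ`, `f_i^ℓ`;
`cs` is the vertex `c*`; `c1 j`, `c2 j` are `c_j¹`, `c_j²`;
`a i j`, `b i j` are the auxiliary vertices `a_{ij}`, `b_{ij}`. -/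
inductive V3 : Type where
  | t (i l : ℕ) : V3
  | z (i l : ℕ) : V3
  | f (i l : ℕ) : V3
  | cs : V3
  | c1 (j : ℕ) : V3
  | c2 (j : ℕ) : V3
  | a (i j : ℕ) : V3
  | b (i j : ℕ) : V3
deriving DecidableEq

/-- A 3-CNF formula with variables `0, …, n-1` and clauses `0, …, m-1`;
the pair `(i, true)` represents the literal `x_i` and `(i, false)` represents `¬x_i`.
Each clause has at most three literals, and no clause contains
both a variable and its negation. -/
structure CNF3 : Type where
  n : ℕ
  m : ℕ
  clause : ℕ → Finset (ℕ × Bool)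
  size_le : ∀ j < m, (clause j).card ≤ 3
  var_lt : ∀ j < m, ∀ p ∈ clause j, p.1 < n
  no_taut : ∀ j < m, ∀ i : ℕ, ¬ ((i, true) ∈ clause j ∧ (i, false) ∈ clause j)

/-- The clauses containing the variable `x_i` (positively or negatively). -/
def occ (φ : CNF3) (i : ℕ) : Finset ℕ :=
  (Finset.range φ.m).filter fun j => (i, true) ∈ φ.clause j ∨ (i, false) ∈ φ.clause j

/-- `μ φ i` is the number of clauses containing `x_i` or `¬x_i`. -/
def μ (φ : CNF3) (i : ℕ) : ℕ := (occ φ i).card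

/-- `posOf φ i j` is the (1-based) position `ℓ` such that clause `j` is
the `ℓ`-th clause containing `x_i` or `¬x_i`. -/
def posOf (φ : CNF3) (i j : ℕ) : ℕ := ((occ φ i).filter fun j' => j' ≤ j).card

/-- The edges of the cycle `X_i`. -/
def Xedges (φ : CNF3) (i : ℕ) : Finset (Sym2 V3) :=
  ((Finset.Ico 1 (6 * μ φ i)).image fun l => s(V3.t i l, V3.t i (l + 1))) ∪
  ((Finset.Ico 1 (6 * μ φ i)).image fun l => s(V3.f i l, V3.f i (l + 1))) ∪
  {s(V3.t i (6 * μ φ i), V3.f i (6 * μ φ i)), s(V3.f i 1, V3.t i 1)}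

/-- The edges of the cycle `Y_{i i'}` where `i' = (i mod n) + 1` (0-based: `(i+1) % n`). -/
def Yedges (φ : CNF3) (i : ℕ) : Finset (Sym2 V3) :=
  {s(V3.t i (6 * μ φ i), V3.f ((i + 1) % φ.n) 1),
   s(V3.f ((i + 1) % φ.n) 1, V3.f i (6 * μ φ i)),
   s(V3.f i (6 * μ φ i), V3.t ((i + 1) % φ.n) 1),
   s(V3.t ((i + 1) % φ.n) 1, V3.t i (6 * μ φ i))}

/-- The edges of the cycle `Z_{ij}` (for a positive occurrence of `x_i` in clause `C_j`). -/
def Zedges (φ : CNF3) (i j : ℕ) : Finset (Sym2 V3) :=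
  {s(V3.t i (6 * posOf φ i j - 3), V3.c1 j),
   s(V3.c1 j, V3.a i j),
   s(V3.a i j, V3.c2 j),
   s(V3.c2 j, V3.t i (6 * posOf φ i j - 2)),
   s(V3.t i (6 * posOf φ i j - 2), V3.b i j),
   s(V3.b i j, V3.t i (6 * posOf φ i j - 3))}

/-- The edges of the cycle `Z̄_{ij}` (for a negative occurrence of `¬x_i` in clause `C_j`). -/
def Zbedges (φ : CNF3) (i j : ℕ) : Finset (Sym2 V3) :=
  {s(V3.f i (6 * posOf φ i j - 3), V3.c1 j),
   s(V3.c1 j, V3.a i j),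
   s(V3.a i j, V3.c2 j),
   s(V3.c2 j, V3.f i (6 * posOf φ i j - 2)),
   s(V3.f i (6 * posOf φ i j - 2), V3.b i j),
   s(V3.b i j, V3.f i (6 * posOf φ i j - 3))}

/-- The edge class `E_0`: all edges of all cycles `X_i`, `Y_{ii'}`, `Z_{ij}`, `Z̄_{ij}`. -/
def E0 (φ : CNF3) : Finset (Sym2 V3) :=
  ((Finset.range φ.n).biUnion fun i => Xedges φ i) ∪
  ((Finset.range φ.n).biUnion fun i => Yedges φ i) ∪
  ((Finset.range φ.m).biUnion fun j =>
    (φ.clause j).biUnion fun p => if p.2 then Zedges φ p.1 j else Zbedges φ p.1 j)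

/-- The edge class `E_i^ℓ`: the edges of the path `P_i^ℓ = (t_i^ℓ, z_i^ℓ, f_i^ℓ)`. -/
def Epl (φ : CNF3) (i l : ℕ) : Finset (Sym2 V3) :=
  {s(V3.t i l, V3.z i l), s(V3.z i l, V3.f i l)}

/-- The edge class `E*`: all edges incident to `c*`,
i.e. the edges of the paths `(c_j¹, c*, c_j²)`. -/
def Estar (φ : CNF3) : Finset (Sym2 V3) :=
  (Finset.range φ.m).biUnion fun j => {s(V3.c1 j, V3.cs), s(V3.cs, V3.c2 j)}

/-- All edges of the constructed graph `G`. -/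
def Eall (φ : CNF3) : Finset (Sym2 V3) :=
  E0 φ ∪ Estar φ ∪
  ((Finset.range φ.n).biUnion fun i => (Finset.Icc 1 (6 * μ φ i)).biUnion fun l => Epl φ i l)

/-- The vertex set `V_FT` of all vertices `t_i^ℓ` and `f_i^ℓ`. -/
def VFT (φ : CNF3) : Set V3 :=
  {v | ∃ i < φ.n, ∃ l : ℕ, 1 ≤ l ∧ l ≤ 6 * μ φ i ∧ (v = V3.t i l ∨ v = V3.f i l)}

/-- The vertex set `V_C` of all vertices `c_j¹` and `c_j²`. -/
def VC (φ : CNF3) : Set V3 :=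
  {v | ∃ j < φ.m, v = V3.c1 j ∨ v = V3.c2 j}


/-- Indices for the edge classes of the constructed instance:
`e0` for `E_0`, `pl i l` for `E_i^ℓ`, `star` for `E*`. -/
inductive CI : Type where
  | e0 : CI
  | pl (i l : ℕ) : CI
  | star : CI
deriving DecidableEq

/-- The edge class with a given index. -/
def classEdges (φ : CNF3) : CI → Finset (Sym2 V3)
  | .e0 => E0 φ
  | .pl i l => Epl φ i l
  | .star => Estar φ

/-- The class indices actually occurring in the constructed instance. -/
def validCI (φ : CNF3) : CI → Prop
  | .e0 => True
  | .pl i l => i < φ.n ∧ 1 ≤ l ∧ l ≤ 6 * μ φ i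
  | .star => True

/-- The (strict) precedence order on the classes: `E_0` precedes every `E_i^ℓ`,
the classes `E_i^ℓ` are ordered lexicographically, and `E*` is incomparable
to all other classes. -/
def prec : CI → CI → Prop
  | .e0, .pl _ _ => True
  | .pl i l, .pl i' l' => i < i' ∨ (i = i' ∧ l < l')
  | _, _ => False

/-- A list of traversed edges respects the precedence constraints: whenever the
edge traversed at step `q` belongs to a class `A`, every edge of every class
`B ≺ A` has already been traversed at some earlier step `p < q`. -/
def PrecRespecting (φ : CNF3) (L : List (Sym2 V3)) : Prop :=
  ∀ (q : ℕ) (hq : q < L.length) (A : CI), validCI φ A → L.get ⟨q, hq⟩ ∈ classEdges φ A →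
    ∀ B : CI, validCI φ B → prec B A → ∀ e ∈ classEdges φ B,
      ∃ (p : ℕ) (hp : p < L.length), p < q ∧ L.get ⟨p, hp⟩ = e

/-- A feasible solution for the constructed HCPP instance: a closed walk in `G`
traversing every edge at least once and respecting the precedence constraints. -/
def FeasibleTour (φ : CNF3) (T : List V3) : Prop :=
  T ≠ [] ∧ T.Chain' (fun a b => s(a, b) ∈ Eall φ) ∧ T.head? = T.getLast? ∧
  (∀ e ∈ Eall φ, e ∈ walkEdges T) ∧ PrecRespecting φ (walkEdgeList T)

/-- The number `b` of imbalanced vertices of the constructed graph `G`. -/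
noncomputable def imb (φ : CNF3) : ℕ := Nat.card {v : V3 // ¬ Even (mDeg (Eall φ).val v)}

/-- A tight tour: a feasible solution of weight at most `|E| + b/2`
(all edges have weight one, so the weight is the number of edge traversals). -/
def IsTightTour (φ : CNF3) (T : List V3) : Prop :=
  FeasibleTour φ T ∧
  ((Multiset.card (walkEdges T) : ℚ) ≤ (Eall φ).card + (imb φ : ℚ) / 2)

/-- The edge `{t_i^{6ℓ−3}, t_i^{6ℓ−2}}` is covered by `M`: it belongs to `M`, or
there is a clause index `j` such that both `{t_i^{6ℓ−3}, c_j¹}` and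
`{t_i^{6ℓ−2}, c_j²}` belong to `M`. -/
def coveredT (φ : CNF3) (M : Multiset (Sym2 V3)) (i l : ℕ) : Prop :=
  s(V3.t i (6 * l - 3), V3.t i (6 * l - 2)) ∈ M ∨
  ∃ j < φ.m, s(V3.t i (6 * l - 3), V3.c1 j) ∈ M ∧ s(V3.t i (6 * l - 2), V3.c2 j) ∈ M

/-- The edge `{f_i^{6ℓ−3}, f_i^{6ℓ−2}}` is covered by `M`: it belongs to `M`, or
there is a clause index `j` such that both `{f_i^{6ℓ−3}, c_j¹}` and
`{f_i^{6ℓ−2}, c_j²}` belong to `M`. -/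
def coveredF (φ : CNF3) (M : Multiset (Sym2 V3)) (i l : ℕ) : Prop :=
  s(V3.f i (6 * l - 3), V3.f i (6 * l - 2)) ∈ M ∨
  ∃ j < φ.m, s(V3.f i (6 * l - 3), V3.c1 j) ∈ M ∧ s(V3.f i (6 * l - 2), V3.c2 j) ∈ M


/-- The vertex `t_i^l` (for `true`) or `f_i^l` (for `false`). -/
def tf (s : Bool) (i l : ℕ) : V3 := cond s (V3.t i l) (V3.f i l)

@[simp] lemma tf_inj (s s' : Bool) (i l i' l' : ℕ) :
    tf s i l = tf s' i' l' ↔ s = s' ∧ i = i' ∧ l = l' := by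
  cases s <;> cases s' <;> simp [tf]

@[simp] lemma tf_ne_z (s : Bool) (i l i' l' : ℕ) : tf s i l ≠ V3.z i' l' := by
  cases s <;> simp [tf]
@[simp] lemma tf_ne_cs (s : Bool) (i l : ℕ) : tf s i l ≠ V3.cs := by
  cases s <;> simp [tf]
@[simp] lemma tf_ne_c1 (s : Bool) (i l j : ℕ) : tf s i l ≠ V3.c1 j := by
  cases s <;> simp [tf]
@[simp] lemma tf_ne_c2 (s : Bool) (i l j : ℕ) : tf s i l ≠ V3.c2 j := by
  cases s <;> simp [tf]
@[simp] lemma tf_ne_a (s : Bool) (i l i' j : ℕ) : tf s i l ≠ V3.a i' j := by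
  cases s <;> simp [tf]
@[simp] lemma tf_ne_b (s : Bool) (i l i' j : ℕ) : tf s i l ≠ V3.b i' j := by
  cases s <;> simp [tf]
@[simp] lemma z_ne_tf (s : Bool) (i l i' l' : ℕ) : V3.z i' l' ≠ tf s i l := by
  cases s <;> simp [tf]
@[simp] lemma cs_ne_tf (s : Bool) (i l : ℕ) : V3.cs ≠ tf s i l := by
  cases s <;> simp [tf]
@[simp] lemma c1_ne_tf (s : Bool) (i l j : ℕ) : V3.c1 j ≠ tf s i l := by
  cases s <;> simp [tf]
@[simp] lemma c2_ne_tf (s : Bool) (i l j : ℕ) : V3.c2 j ≠ tf s i l := by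
  cases s <;> simp [tf]
@[simp] lemma a_ne_tf (s : Bool) (i l i' j : ℕ) : V3.a i' j ≠ tf s i l := by
  cases s <;> simp [tf]
@[simp] lemma b_ne_tf (s : Bool) (i l i' j : ℕ) : V3.b i' j ≠ tf s i l := by
  cases s <;> simp [tf]

lemma t_eq (i l : ℕ) : V3.t i l = tf true i l := rfl
lemma f_eq (i l : ℕ) : V3.f i l = tf false i l := rfl

/-- Edges of the cycle `Z_{ij}` or of `Z̄_{ij}`, depending on the sign. -/
def ZZ (φ : CNF3) (s : Bool) (i j : ℕ) : Finset (Sym2 V3) :=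
  {s(tf s i (6 * posOf φ i j - 3), V3.c1 j),
   s(V3.c1 j, V3.a i j),
   s(V3.a i j, V3.c2 j),
   s(V3.c2 j, tf s i (6 * posOf φ i j - 2)),
   s(tf s i (6 * posOf φ i j - 2), V3.b i j),
   s(V3.b i j, tf s i (6 * posOf φ i j - 3))}

/-- Condition satisfied by edges between two vertices of `V_FT`. -/
def TTc (s : Bool) (i l : ℕ) (s' : Bool) (i' l' : ℕ) : Prop :=
  i = i' → (l' = l + 1 ∨ l = l' + 1) → s = s'

lemma mem_E0_ZZ (φ : CNF3) (s : Bool) (i j : ℕ) (hj : j < φ.m) (hc : (i, s) ∈ φ.clause j)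
    (e : Sym2 V3) (he : e ∈ ZZ φ s i j) : e ∈ E0 φ := by
  unfold E0
  apply Finset.mem_union_right
  simp only [Finset.mem_biUnion, Finset.mem_range]
  refine ⟨j, hj, (i, s), hc, ?_⟩
  cases s <;> exact he

lemma mem_E0 (φ : CNF3) (hμ : ∀ i < φ.n, 1 ≤ μ φ i) (e : Sym2 V3) (he : e ∈ E0 φ) :
    (∃ s i l s' i' l', e = s(tf s i l, tf s' i' l') ∧ TTc s i l s' i' l') ∨
    (∃ s i j, j < φ.m ∧ (i, s) ∈ φ.clause j ∧ e ∈ ZZ φ s i j) := by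
  unfold E0 at he
  rw [Finset.mem_union, Finset.mem_union] at he
  rcases he with (he | he) | he
  · left
    simp only [Finset.mem_biUnion, Finset.mem_range] at he
    obtain ⟨i, hi, he⟩ := he
    have := hμ i hi
    simp only [Xedges, Finset.mem_union, Finset.mem_image, Finset.mem_Ico, Finset.mem_insert,
      Finset.mem_singleton] at he
    rcases he with (⟨l, hl, rfl⟩ | ⟨l, hl, rfl⟩) | rfl | rfl
    · exact ⟨true, i, l, true, i, l + 1, rfl, fun _ _ => rfl⟩
    · exact ⟨false, i, l, false, i, l + 1, rfl, fun _ _ => rfl⟩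
    · exact ⟨true, i, _, false, i, _, rfl, fun _ _ => by omega⟩
    · exact ⟨false, i, _, true, i, _, rfl, fun _ _ => by omega⟩
  · left
    simp only [Finset.mem_biUnion, Finset.mem_range] at he
    obtain ⟨i, hi, he⟩ := he
    have := hμ i hi
    simp only [Yedges, Finset.mem_insert, Finset.mem_singleton] at he
    rcases he with rfl | rfl | rfl | rfl
    · exact ⟨true, i, _, false, _, _, rfl, fun _ _ => by omega⟩
    · exact ⟨false, _, _, false, i, _, rfl, fun _ _ => rfl⟩
    · exact ⟨false, i, _, true, _, _, rfl, fun _ _ => by omega⟩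
    · exact ⟨true, _, _, true, _, _, rfl, fun _ _ => rfl⟩
  · right
    simp only [Finset.mem_biUnion, Finset.mem_range] at he
    obtain ⟨j, hj, ⟨i, s⟩, hc, he⟩ := he
    refine ⟨s, i, j, hj, hc, ?_⟩
    cases s <;> exact he

lemma mem_Eall (φ : CNF3) (e : Sym2 V3) : e ∈ Eall φ ↔
    e ∈ E0 φ ∨ (∃ j < φ.m, e = s(V3.c1 j, V3.cs) ∨ e = s(V3.cs, V3.c2 j)) ∨
    (∃ s i l, validCI φ (.pl i l) ∧ e = s(tf s i l, V3.z i l)) := by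
  unfold Eall Estar Epl
  simp only [Finset.mem_union, Finset.mem_biUnion, Finset.mem_range, Finset.mem_insert,
    Finset.mem_singleton, Finset.mem_Icc, validCI, or_assoc]
  refine or_congr_right (or_congr_right ?_)
  constructor
  · rintro ⟨i, hi, l, hl, rfl | rfl⟩
    · exact ⟨true, i, l, ⟨hi, hl⟩, rfl⟩
    · exact ⟨false, i, l, ⟨hi, hl⟩, Sym2.eq_swap⟩
  · rintro ⟨s, i, l, ⟨hi, hl⟩, rfl⟩
    refine ⟨i, hi, l, hl, ?_⟩
    cases s
    · right; exact Sym2.eq_swap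
    · left; rfl

lemma mem_Epl (φ : CNF3) (s : Bool) (i l : ℕ) : s(tf s i l, V3.z i l) ∈ Epl φ i l := by
  cases s <;> simp [Epl, tf]


lemma adj_z (φ : CNF3) (hμ : ∀ i < φ.n, 1 ≤ μ φ i)
    (i l : ℕ) (y : V3) (h : s(V3.z i l, y) ∈ Eall φ) :
    validCI φ (.pl i l) ∧ ∃ s, y = tf s i l := by
  rcases (mem_Eall _ _).1 h with h | ⟨j, hj, h⟩ | ⟨s, i, l, hv, h⟩
  · rcases mem_E0 φ hμ _ h with ⟨s, i, l, s', i', l', h, hc⟩ | ⟨s, i, j, hj, hc, h⟩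
    · simp at h
    · simp [ZZ] at h
  · simp at h
  · simp at h
    obtain ⟨⟨rfl, rfl⟩, rfl⟩ := h
    exact ⟨hv, s, rfl⟩

lemma E0_tf (φ : CNF3) (hμ : ∀ i < φ.n, 1 ≤ μ φ i)
    (s : Bool) (i l : ℕ) (y : V3) (h : s(tf s i l, y) ∈ E0 φ) :
    (∃ s' i' l', y = tf s' i' l' ∧ TTc s i l s' i' l') ∨
    (∃ j < φ.m, (i, s) ∈ φ.clause j ∧ l = 6 * posOf φ i j - 3 ∧ y = V3.c1 j) ∨
    (∃ j < φ.m, (i, s) ∈ φ.clause j ∧ l = 6 * posOf φ i j - 2 ∧ y = V3.c2 j) ∨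
    (∃ j, y = V3.b i j) := by
  rcases mem_E0 φ hμ _ h with ⟨s1, i1, l1, s', i', l', h, hc⟩ | ⟨s1, i1, j, hj, hc, h⟩
  · left
    simp only [Sym2.eq_iff, tf_inj] at h
    rcases h with ⟨⟨rfl, rfl, rfl⟩, rfl⟩ | ⟨⟨rfl, rfl, rfl⟩, rfl⟩
    · exact ⟨_, _, _, rfl, hc⟩
    · exact ⟨_, _, _, rfl, fun h1 h2 => (hc h1.symm h2.symm).symm⟩
  · right
    simp [ZZ] at h
    rcases h with h | h | h | h
    · obtain ⟨⟨rfl, rfl, rfl⟩, rfl⟩ := h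
      exact Or.inl ⟨j, hj, hc, rfl, rfl⟩
    · obtain ⟨⟨rfl, rfl, rfl⟩, rfl⟩ := h
      exact Or.inr (Or.inl ⟨j, hj, hc, rfl, rfl⟩)
    · obtain ⟨⟨rfl, rfl, rfl⟩, rfl⟩ := h
      exact Or.inr (Or.inr ⟨_, rfl⟩)
    · obtain ⟨⟨rfl, rfl, rfl⟩, rfl⟩ := h
      exact Or.inr (Or.inr ⟨_, rfl⟩)

lemma adj_tf (φ : CNF3)
    (s : Bool) (i l : ℕ) (y : V3) (h : s(tf s i l, y) ∈ Eall φ) :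
    s(tf s i l, y) ∈ E0 φ ∨ (validCI φ (.pl i l) ∧ y = V3.z i l) := by
  rcases (mem_Eall _ _).1 h with h | ⟨j, hj, h⟩ | ⟨s, i, l, hv, h⟩
  · exact Or.inl h
  · simp at h
  · right
    simp at h
    obtain ⟨⟨rfl, rfl, rfl⟩, rfl⟩ := h
    exact ⟨hv, rfl⟩

lemma adj_cs (φ : CNF3) (hμ : ∀ i < φ.n, 1 ≤ μ φ i)
    (y : V3) (h : s(V3.cs, y) ∈ Eall φ) : ∃ j < φ.m, y = V3.c1 j ∨ y = V3.c2 j := by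
  rcases (mem_Eall _ _).1 h with h | ⟨j, hj, h⟩ | ⟨s, i, l, hv, h⟩
  · rcases mem_E0 φ hμ _ h with ⟨s, i, l, s', i', l', h, hc⟩ | ⟨s, i, j, hj, hc, h⟩
    · simp at h
    · simp [ZZ] at h
  · refine ⟨j, hj, ?_⟩
    simpa using h
  · simp at h

lemma adj_c1 (φ : CNF3) (hμ : ∀ i < φ.n, 1 ≤ μ φ i)
    (j : ℕ) (y : V3) (h : s(V3.c1 j, y) ∈ Eall φ) :
    y = V3.cs ∨ (s(V3.c1 j, y) ∈ E0 φ ∧ ((∃ i, y = V3.a i j) ∨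
      ∃ s i, (i, s) ∈ φ.clause j ∧ y = tf s i (6 * posOf φ i j - 3))) := by
  rcases (mem_Eall _ _).1 h with h | ⟨j, hj, h⟩ | ⟨s, i, l, hv, h⟩
  · right
    refine ⟨h, ?_⟩
    rcases mem_E0 φ hμ _ h with ⟨s, i, l, s', i', l', h, hc⟩ | ⟨s, i, j, hj, hc, h⟩
    · simp at h
    · simp [ZZ] at h
      rcases h with ⟨rfl, rfl⟩ | ⟨rfl, rfl⟩
      · exact Or.inr ⟨s, i, hc, rfl⟩
      · exact Or.inl ⟨i, rfl⟩
  · simp at h; exact Or.inl h.2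
  · simp at h

lemma adj_c2 (φ : CNF3) (hμ : ∀ i < φ.n, 1 ≤ μ φ i)
    (j : ℕ) (y : V3) (h : s(V3.c2 j, y) ∈ Eall φ) :
    y = V3.cs ∨ (s(V3.c2 j, y) ∈ E0 φ ∧ ((∃ i, y = V3.a i j) ∨
      ∃ s i, (i, s) ∈ φ.clause j ∧ y = tf s i (6 * posOf φ i j - 2))) := by
  rcases (mem_Eall _ _).1 h with h | ⟨j, hj, h⟩ | ⟨s, i, l, hv, h⟩
  · right
    refine ⟨h, ?_⟩
    rcases mem_E0 φ hμ _ h with ⟨s, i, l, s', i', l', h, hc⟩ | ⟨s, i, j, hj, hc, h⟩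
    · simp at h
    · simp [ZZ] at h
      rcases h with ⟨rfl, rfl⟩ | ⟨rfl, rfl⟩
      · exact Or.inl ⟨i, rfl⟩
      · exact Or.inr ⟨s, i, hc, rfl⟩
  · simp at h; exact Or.inl h.2
  · simp at h

lemma z_not_E0 (φ : CNF3) (hμ : ∀ i < φ.n, 1 ≤ μ φ i)
    (i l : ℕ) (y : V3) : s(y, V3.z i l) ∉ E0 φ := by
  intro h
  rcases mem_E0 φ hμ _ h with ⟨s, i, l, s', i', l', h, hc⟩ | ⟨s, i, j, hj, hc, h⟩
  · simp at h
  · simp [ZZ] at h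

lemma E0_nonempty (φ : CNF3)
    (hn : 0 < φ.n) : ∃ e, e ∈ E0 φ := by
  refine ⟨s(V3.f 0 1, V3.t 0 1), ?_⟩
  unfold E0
  simp only [Finset.mem_union, Finset.mem_biUnion, Finset.mem_range]
  exact Or.inl (Or.inl ⟨0, hn, by simp [Xedges]⟩)

/-- Edges at `a`. -/
lemma adj_a (φ : CNF3) (hμ : ∀ i < φ.n, 1 ≤ μ φ i)
    (i j : ℕ) (e : Sym2 V3) (h : e ∈ Eall φ) (he : V3.a i j ∈ e) :
    (∃ s, j < φ.m ∧ (i, s) ∈ φ.clause j) ∧ (e = s(V3.c1 j, V3.a i j) ∨ e = s(V3.a i j, V3.c2 j)) := by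
  rcases (mem_Eall _ _).1 h with h | ⟨j, hj, h⟩ | ⟨s, i, l, hv, h⟩
  · rcases mem_E0 φ hμ _ h with ⟨s, i, l, s', i', l', h, hc⟩ | ⟨s, i, j, hj, hc, h⟩
    · simp [h] at he
    · simp [ZZ] at h
      rcases h with h | h | h | h | h | h
      all_goals simp [h] at he
      all_goals
        obtain ⟨rfl, rfl⟩ := he
        exact ⟨⟨s, hj, hc⟩, by simp [h]⟩
  · rcases h with h | h <;> simp [h] at he
  · simp [h] at he

lemma adj_b (φ : CNF3) (hμ : ∀ i < φ.n, 1 ≤ μ φ i)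
    (i j : ℕ) (e : Sym2 V3) (h : e ∈ Eall φ) (he : V3.b i j ∈ e) :
    ∃ s, j < φ.m ∧ (i, s) ∈ φ.clause j ∧ (e = s(tf s i (6 * posOf φ i j - 2), V3.b i j) ∨
      e = s(V3.b i j, tf s i (6 * posOf φ i j - 3))) := by
  rcases (mem_Eall _ _).1 h with h | ⟨j, hj, h⟩ | ⟨s, i, l, hv, h⟩
  · rcases mem_E0 φ hμ _ h with ⟨s, i, l, s', i', l', h, hc⟩ | ⟨s, i, j, hj, hc, h⟩
    · simp [h] at he
    · simp [ZZ] at h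
      rcases h with h | h | h | h | h | h
      all_goals simp [h] at he
      all_goals
        obtain ⟨rfl, rfl⟩ := he
        exact ⟨s, hj, hc, by simp [h]⟩
  · rcases h with h | h <;> simp [h] at he
  · simp [h] at he


lemma posOf_pos (φ : CNF3) (i j : ℕ) (s : Bool) (hj : j < φ.m) (h : (i, s) ∈ φ.clause j) :
    j ∈ occ φ i ∧ 1 ≤ posOf φ i j := by
  have h1 : j ∈ occ φ i := by
    cases s <;> simp [occ, hj, h]
  refine ⟨h1, Finset.card_pos.2 ⟨j, by simp [h1]⟩⟩

lemma posOf_inj (φ : CNF3) (i j k : ℕ) (hj : j ∈ occ φ i) (hk : k ∈ occ φ i)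
    (h : posOf φ i j = posOf φ i k) : j = k := by
  have key : ∀ j k, j ∈ occ φ i → k ∈ occ φ i → j < k → posOf φ i j < posOf φ i k := by
    intro j k hj hk hjk
    apply Finset.card_lt_card
    rw [Finset.ssubset_iff_of_subset]
    · exact ⟨k, by simp [hk], by simp [hjk]⟩
    · intro x; simp; intro h1 h2; exact ⟨h1, by omega⟩
  rcases lt_trichotomy j k with h1 | h1 | h1
  · have := key _ _ hj hk h1; omega
  · exact h1
  · have := key _ _ hk hj h1; omega

/-- The properties of a tight tour which are used in the combinatorial argument. The walk is
`g 0, …, g N`, and `M` is the multiset of excess edges. -/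
structure WalkData (φ : CNF3) (g : ℕ → V3) (N : ℕ) (M : Multiset (Sym2 V3)) : Prop where
  edge : ∀ k < N, s(g k, g (k + 1)) ∈ Eall φ
  precR : ∀ q < N, ∀ A : CI, validCI φ A → s(g q, g (q + 1)) ∈ classEdges φ A →
    ∀ B : CI, validCI φ B → prec B A → ∀ e ∈ classEdges φ B,
      ∃ p < q, s(g p, g (p + 1)) = e
  all : ∀ e ∈ Eall φ, ∃ k < N, s(g k, g (k + 1)) = e
  closed : g 0 = g N
  twice : ∀ p q, p < q → q < N → s(g p, g (p + 1)) = s(g q, g (q + 1)) → s(g q, g (q + 1)) ∈ M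
  thrice : ∀ p q r, p < q → q < r → r < N → s(g p, g (p + 1)) = s(g r, g (r + 1)) →
    s(g q, g (q + 1)) = s(g r, g (r + 1)) → False
  matching : ∀ e ∈ M, ∀ e' ∈ M, ∀ v, v ∈ e → v ∈ e' → e = e'
  even_z : ∀ e ∈ M, ∀ i l, V3.z i l ∉ e
  even_cs : ∀ e ∈ M, V3.cs ∉ e
  even_a : ∀ e ∈ M, ∀ i j, V3.a i j ∉ e
  even_b : ∀ e ∈ M, ∀ i j, V3.b i j ∉ e

namespace WalkData

variable {φ : CNF3} {g : ℕ → V3} {N : ℕ} {M : Multiset (Sym2 V3)}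

lemma once (W : WalkData φ g N M) (p q : ℕ) (hp : p < N) (hq : q < N) (v : V3)
    (hv : v ∈ s(g q, g (q + 1))) (hM : ∀ e ∈ M, v ∉ e)
    (h : s(g p, g (p + 1)) = s(g q, g (q + 1))) : p = q := by
  rcases lt_trichotomy p q with h1 | h1 | h1
  · exact absurd hv (hM _ (W.twice p q h1 hq h))
  · exact h1
  · exact absurd hv (h ▸ hM _ (W.twice q p h1 hp h.symm))

lemma once_z (W : WalkData φ g N M) (p q : ℕ) (hp : p < N) (hq : q < N) (x : V3) (i l : ℕ)
    (h1 : s(g p, g (p + 1)) = s(x, V3.z i l)) (h2 : s(g q, g (q + 1)) = s(x, V3.z i l)) :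
    p = q := by
  apply W.once p q hp hq (V3.z i l) (by simp [h2]) (fun e he => W.even_z e he i l) (h1.trans h2.symm)

/-- After the first edge of a path `P_i^l`, all edges of `E_0` are in `M`. -/
lemma mem_M (W : WalkData φ g N M) (p q : ℕ) (hpq : p < q) (hq : q < N) (s : Bool) (i l : ℕ)
    (hv : validCI φ (.pl i l)) (hp : s(g p, g (p + 1)) = s(tf s i l, V3.z i l))
    (hE : s(g q, g (q + 1)) ∈ E0 φ) :
    s(g q, g (q + 1)) ∈ M ∧ ∃ r < p, s(g r, g (r + 1)) = s(g q, g (q + 1)) := by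
  obtain ⟨r, hr, he⟩ := W.precR p (by omega) (.pl i l) hv (hp ▸ mem_Epl φ s i l) .e0 trivial trivial
    _ hE
  exact ⟨W.twice r q (by omega) hq he, r, hr, he⟩

lemma next (W : WalkData φ g N M) (p q : ℕ) (hpq : p < q) (hq : q + 1 < N) (s : Bool) (i l : ℕ)
    (hv : validCI φ (.pl i l)) (hp : s(g p, g (p + 1)) = s(tf s i l, V3.z i l))
    (hE : s(g q, g (q + 1)) ∈ E0 φ) : s(g (q + 1), g (q + 1 + 1)) ∉ E0 φ := by
  intro hE'
  obtain ⟨h1, r, hr, he⟩ := W.mem_M p q hpq (by omega) s i l hv hp hE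
  obtain ⟨h2, -⟩ := W.mem_M p (q + 1) (by omega) hq s i l hv hp hE'
  have h3 := W.matching _ h1 _ h2 (g (q + 1)) (by simp) (by simp)
  exact W.thrice r q (q + 1) (by omega) (by omega) hq (he.trans h3) h3

/-- The walk traverses `P_i^l` at position `k`, leaving it at the end of type `s`. -/
def ExitAt (φ : CNF3) (g : ℕ → V3) (N i l k : ℕ) (s : Bool) : Prop :=
  k + 2 ≤ N ∧ g k = tf (!s) i l ∧ g (k + 1) = V3.z i l ∧ g (k + 2) = tf s i l

lemma exists_exit (W : WalkData φ g N M) (hμ : ∀ i < φ.n, 1 ≤ μ φ i) (i l : ℕ)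
    (hv : validCI φ (.pl i l)) : ∃ k s, ExitAt φ g N i l k s := by
  have hmem : s(tf true i l, V3.z i l) ∈ Eall φ :=
    (mem_Eall _ _).2 (Or.inr (Or.inr ⟨true, i, l, hv, rfl⟩))
  obtain ⟨e0, he0⟩ := E0_nonempty φ (by have := hv.1; omega)
  have pos : ∀ s q, q < N → s(g q, g (q + 1)) = s(tf s i l, V3.z i l) → 0 < q := by
    intro s q hq h
    obtain ⟨p, hp, -⟩ := W.precR q hq (.pl i l) hv (h ▸ mem_Epl φ s i l) .e0 trivial trivial
      _ he0
    omega
  obtain ⟨q, hq, hqe⟩ := W.all _ hmem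
  have hq0 := pos _ q hq hqe
  have hqe' := hqe
  rw [Sym2.eq_iff] at hqe
  rcases hqe with ⟨h1, h2⟩ | ⟨h1, h2⟩
  · have hN : q + 1 < N := by
      by_contra hcon
      have : q + 1 = N := by omega
      have h0 : g 0 = V3.z i l := by rw [W.closed, ← this, h2]
      have h3 := W.edge 0 (by omega)
      rw [h0] at h3
      obtain ⟨-, s, hs⟩ := adj_z φ hμ _ _ _ h3
      have := pos s 0 (by omega) (by rw [h0, hs, Sym2.eq_swap])
      omega
    have h3 := W.edge (q + 1) hN
    rw [h2] at h3
    obtain ⟨-, s, hs⟩ := adj_z φ hμ _ _ _ h3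
    cases s
    · exact ⟨q, false, by omega, h1, h2, hs⟩
    · have := W.once_z q (q + 1) hq hN _ _ _ hqe' (by rw [h2, hs, Sym2.eq_swap])
      omega
  · obtain ⟨q, rfl⟩ : ∃ r, q = r + 1 := ⟨q - 1, by omega⟩
    have h3 := W.edge q (by omega)
    rw [h1, Sym2.eq_swap] at h3
    obtain ⟨-, s, hs⟩ := adj_z φ hμ _ _ _ h3
    cases s
    · exact ⟨q, true, by omega, hs, h1, h2⟩
    · have := W.once_z q (q + 1) (by omega) hq _ _ _ (by rw [h1, hs]) hqe'
      omega

lemma ExitAt.e1 {i l k : ℕ} {s : Bool} (h : ExitAt φ g N i l k s) :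
    s(g k, g (k + 1)) = s(tf (!s) i l, V3.z i l) := by
  rw [h.2.1, h.2.2.1]

lemma ExitAt.e2 {i l k : ℕ} {s : Bool} (h : ExitAt φ g N i l k s) :
    s(g (k + 1), g (k + 1 + 1)) = s(tf s i l, V3.z i l) := by
  rw [h.2.2.1, show k + 1 + 1 = k + 2 from rfl, h.2.2.2, Sym2.eq_swap]

/-- The next path edge traversed after `P_i^l` is the first edge of `P_i^{l+1}`. -/
lemma ord (W : WalkData φ g N M) (i l k k' : ℕ) (s s' : Bool) (hv : validCI φ (.pl i l))
    (hv' : validCI φ (.pl i (l + 1))) (h : ExitAt φ g N i l k s)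
    (h' : ExitAt φ g N i (l + 1) k' s') (q : ℕ) (hq : k + 1 < q) (hq' : q ≤ k')
    (s1 : Bool) (i1 l1 : ℕ) (hv1 : validCI φ (.pl i1 l1))
    (he : s(g q, g (q + 1)) = s(tf s1 i1 l1, V3.z i1 l1)) : i1 = i ∧ l1 = l + 1 ∧ s1 = !s' := by
  have hk := h.1
  have hk' := h'.1
  have c1 : ¬ prec (.pl i1 l1) (.pl i l) := by
    intro hp
    obtain ⟨p, hp, hpe⟩ := W.precR k (by omega) (.pl i l) hv (h.e1 ▸ mem_Epl φ _ i l) _ hv1 hp _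
      (mem_Epl φ s1 i1 l1)
    have := W.once_z p q (by omega) (by omega) _ _ _ hpe he
    omega
  have c2 : ¬ (i1 = i ∧ l1 = l) := by
    rintro ⟨rfl, rfl⟩
    by_cases hs : s1 = s
    · subst hs
      have := W.once_z q (k + 1) (by omega) (by omega) _ _ _ he h.e2
      omega
    · have : s1 = !s := by cases s1 <;> cases s <;> simp_all
      subst this
      have := W.once_z q k (by omega) (by omega) _ _ _ he h.e1
      omega
  have c3 : ¬ prec (.pl i (l + 1)) (.pl i1 l1) := by
    intro hp
    obtain ⟨p, hp, hpe⟩ := W.precR q (by omega) (.pl i1 l1) hv1 (he ▸ mem_Epl φ _ i1 l1) _ hv' hp _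
      (mem_Epl φ (!s') i (l + 1))
    have := W.once_z p k' (by omega) (by omega) _ _ _ hpe h'.e1
    omega
  simp only [prec] at c1 c3
  have hi : i1 = i ∧ l1 = l + 1 := by omega
  refine ⟨hi.1, hi.2, ?_⟩
  obtain ⟨rfl, rfl⟩ := hi
  by_contra hs
  have : s1 = s' := by cases s1 <;> cases s' <;> simp_all
  subst this
  have := W.once_z q (k' + 1) (by omega) (by omega) _ _ _ he h'.e2
  omega

/-- The vertices `t_i^l`, `t_i^{l+1}` (or `f_i^l`, `f_i^{l+1}`) are linked by `M`. -/
def Link (φ : CNF3) (M : Multiset (Sym2 V3)) (s : Bool) (i l : ℕ) : Prop :=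
  s(tf s i l, tf s i (l + 1)) ∈ M ∨
  ∃ j < φ.m, l = 6 * posOf φ i j - 3 ∧ s(tf s i l, V3.c1 j) ∈ M ∧ s(tf s i (l + 1), V3.c2 j) ∈ M

lemma step (W : WalkData φ g N M) (hμ : ∀ i < φ.n, 1 ≤ μ φ i) (i l k k' : ℕ) (s s' : Bool)
    (hv : validCI φ (.pl i l)) (hv' : validCI φ (.pl i (l + 1))) (h : ExitAt φ g N i l k s)
    (h' : ExitAt φ g N i (l + 1) k' s') : Link φ M s i l ∧ s' = !s := by
  have hk := h.1
  have hk' := h'.1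
  have hkk : k + 1 < k' := by
    obtain ⟨p, hp, hpe⟩ := W.precR k' (by omega) (.pl i (l + 1)) hv' (h'.e1 ▸ mem_Epl φ _ i _)
      (.pl i l) hv (Or.inr ⟨rfl, by omega⟩) _ (mem_Epl φ s i l)
    have := W.once_z p (k + 1) (by omega) (by omega) _ _ _ hpe h.e2
    omega
  have hg2 := h.2.2.2
  have hgk' := h'.2.1
  have nk : ∀ r, k + 1 < r → r ≤ k' → g r ≠ tf (!s') i (l + 1) → r + 1 ≤ k' := by
    intro r _ hr hne
    rcases Nat.lt_or_ge r k' with h1 | h1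
    · omega
    · have : r = k' := by omega
      subst this
      exact absurd hgk' hne
  have h3 : k + 3 ≤ k' := nk (k + 2) (by omega) (by omega) (by rw [hg2]; simp)
  have ed2 := W.edge (k + 2) (by omega)
  have hE2 : s(g (k + 2), g (k + 2 + 1)) ∈ E0 φ := by
    rw [hg2] at ed2 ⊢
    rcases adj_tf φ _ _ _ _ ed2 with h4 | ⟨-, h4⟩
    · exact h4
    · have := W.once_z (k + 2) (k + 1) (by omega) (by omega) _ _ _ (by rw [hg2, h4]) h.e2
      omega
  obtain ⟨hM2, -⟩ := W.mem_M k (k + 2) (by omega) (by omega) _ _ _ hv h.e1 hE2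
  have hn3 := W.next k (k + 2) (by omega) (by omega) _ _ _ hv h.e1 hE2
  have hE2' := hE2
  rw [hg2] at hE2' hM2
  change s(g (k + 3), g (k + 4)) ∉ E0 φ at hn3
  change s(tf s i l, g (k + 3)) ∈ M at hM2
  have ed3 : s(g (k + 3), g (k + 4)) ∈ Eall φ := W.edge (k + 3) (by omega)
  -- the part of the walk through `c*`
  have cpart : ∀ j, (g (k + 3) = V3.c1 j ∨ g (k + 3) = V3.c2 j) →
      ∃ j' < φ.m, (i, !s') ∈ φ.clause j' ∧
        ((s(tf (!s') i (l + 1), V3.c1 j') ∈ M ∧ l + 1 = 6 * posOf φ i j' - 3) ∨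
         (s(tf (!s') i (l + 1), V3.c2 j') ∈ M ∧ l + 1 = 6 * posOf φ i j' - 2)) := by
    intro j hj
    have h4 : k + 4 ≤ k' := nk (k + 3) (by omega) (by omega) (by
      rcases hj with hj | hj <;> rw [hj] <;> simp)
    have g4 : g (k + 4) = V3.cs := by
      rcases hj with hj | hj
      · rw [hj] at ed3 hn3
        rcases adj_c1 φ hμ _ _ ed3 with h5 | ⟨h5, -⟩
        · exact h5
        · exact absurd h5 hn3
      · rw [hj] at ed3 hn3
        rcases adj_c2 φ hμ _ _ ed3 with h5 | ⟨h5, -⟩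
        · exact h5
        · exact absurd h5 hn3
    have h5 : k + 5 ≤ k' := nk (k + 4) (by omega) (by omega) (by rw [g4]; simp)
    have ed4 : s(g (k + 4), g (k + 5)) ∈ Eall φ := W.edge (k + 4) (by omega)
    rw [g4] at ed4
    obtain ⟨j', hj', hg5⟩ := adj_cs φ hμ _ ed4
    have h6 : k + 6 ≤ k' := nk (k + 5) (by omega) (by omega) (by
      rcases hg5 with hj | hj <;> rw [hj] <;> simp)
    have ed5 : s(g (k + 5), g (k + 6)) ∈ Eall φ := W.edge (k + 5) (by omega)
    have n6 : g (k + 6) ≠ V3.cs := by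
      intro hc
      have := W.once (k + 4) (k + 5) (by omega) (by omega) V3.cs (by simp [hc]) W.even_cs
        (by simp [g4, hc])
      omega
    have fin : s(g (k + 5), g (k + 6)) ∈ E0 φ → ∀ s1 i1 l1, g (k + 6) = tf s1 i1 l1 →
        s(g (k + 5), g (k + 6)) ∈ M ∧ i1 = i ∧ l1 = l + 1 ∧ s1 = !s' := by
      intro hE s1 i1 l1 hg6
      have hM5 := (W.mem_M k (k + 5) (by omega) (by omega) _ _ _ hv h.e1 hE).1
      have hn6 := W.next k (k + 5) (by omega) (by omega) _ _ _ hv h.e1 hE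
      have ed6 : s(g (k + 6), g (k + 6 + 1)) ∈ Eall φ := W.edge (k + 6) (by omega)
      change s(g (k + 6), g (k + 6 + 1)) ∉ E0 φ at hn6
      refine ⟨hM5, ?_⟩
      rw [hg6] at ed6 hn6
      rcases adj_tf φ _ _ _ _ ed6 with h7 | ⟨hv1, h7⟩
      · exact absurd h7 hn6
      · exact W.ord i l k k' s s' hv hv' h h' (k + 6) (by omega) h6 s1 i1 l1 hv1
          (by rw [hg6, h7])
    have na : s(g (k + 5), g (k + 6)) ∈ E0 φ → ∀ i1 j1, g (k + 6) ≠ V3.a i1 j1 := by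
      intro hE i1 j1 hc
      have hM5 := (W.mem_M k (k + 5) (by omega) (by omega) _ _ _ hv h.e1 hE).1
      exact W.even_a _ hM5 i1 j1 (by simp [hc])
    refine ⟨j', hj', ?_⟩
    rcases hg5 with hg5 | hg5
    · rw [hg5] at ed5
      rcases adj_c1 φ hμ _ _ ed5 with h7 | ⟨hE, h7⟩
      · exact absurd h7 n6
      rw [← hg5] at hE
      rcases h7 with ⟨i1, h7⟩ | ⟨s1, i1, hc, h7⟩
      · exact absurd h7 (na hE _ _)
      obtain ⟨hM5, rfl, hl, rfl⟩ := fin hE _ _ _ h7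
      rw [hg5, h7, hl, Sym2.eq_swap] at hM5
      exact ⟨hc, Or.inl ⟨hM5, hl.symm⟩⟩
    · rw [hg5] at ed5
      rcases adj_c2 φ hμ _ _ ed5 with h7 | ⟨hE, h7⟩
      · exact absurd h7 n6
      rw [← hg5] at hE
      rcases h7 with ⟨i1, h7⟩ | ⟨s1, i1, hc, h7⟩
      · exact absurd h7 (na hE _ _)
      obtain ⟨hM5, rfl, hl, rfl⟩ := fin hE _ _ _ h7
      rw [hg5, h7, hl, Sym2.eq_swap] at hM5
      exact ⟨hc, Or.inr ⟨hM5, hl.symm⟩⟩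
  have hl1 := hv.2.1
  rcases E0_tf φ hμ _ _ _ _ hE2' with ⟨s1, i1, l1, hg, hT⟩ | ⟨j, hj, hc, hl, hg⟩ |
    ⟨j, hj, hc, hl, hg⟩ | ⟨j, hg⟩
  · change g (k + 3) = _ at hg
    rw [hg] at ed3 hn3 hM2
    rcases adj_tf φ _ _ _ _ ed3 with h4 | ⟨hv1, h4⟩
    · exact absurd h4 hn3
    obtain ⟨rfl, rfl, rfl⟩ := W.ord i l k k' s s' hv hv' h h' (k + 3) (by omega) h3 s1 i1 l1 hv1
      (by rw [hg, show k + 3 + 1 = k + 4 from rfl, h4])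
    have := hT rfl (Or.inl rfl)
    subst this
    exact ⟨Or.inl hM2, by simp⟩
  · change g (k + 3) = _ at hg
    obtain ⟨j', hj', hc', h4⟩ := cpart j (Or.inl hg)
    obtain ⟨o1, p1⟩ := posOf_pos φ i j s hj hc
    obtain ⟨o2, p2⟩ := posOf_pos φ i j' _ hj' hc'
    rcases h4 with ⟨h4, h5⟩ | ⟨h4, h5⟩
    · omega
    have := posOf_inj φ i j j' o1 o2 (by omega)
    subst this
    have hs : (!s') = s := by
      have := φ.no_taut j hj i
      cases s <;> cases s' <;> simp_all
    rw [hs] at h4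
    rw [hg] at hM2
    exact ⟨Or.inr ⟨j, hj, hl, hM2, h4⟩, by rw [← hs]; simp⟩
  · change g (k + 3) = _ at hg
    obtain ⟨j', hj', hc', h4⟩ := cpart j (Or.inr hg)
    obtain ⟨o1, p1⟩ := posOf_pos φ i j s hj hc
    obtain ⟨o2, p2⟩ := posOf_pos φ i j' _ hj' hc'
    omega
  · change g (k + 3) = _ at hg
    exact absurd (show V3.b i j ∈ _ by simp [hg]) (W.even_b _ hM2 i j)

lemma links (W : WalkData φ g N M) (hμ : ∀ i < φ.n, 1 ≤ μ φ i) (i : ℕ) (hi : i < φ.n) :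
    ∃ s, ∀ l, 1 ≤ l → l < 6 * μ φ i → Link φ M (if l % 2 = 1 then s else !s) i l := by
  have hm := hμ i hi
  have val : ∀ l, 1 ≤ l → l ≤ 6 * μ φ i → validCI φ (.pl i l) := fun l h1 h2 => ⟨hi, h1, h2⟩
  obtain ⟨k, s, hk⟩ := W.exists_exit hμ i 1 (val 1 le_rfl (by omega))
  have key : ∀ l, l < 6 * μ φ i → ∃ k, ExitAt φ g N i (l + 1) k
      (if (l + 1) % 2 = 1 then s else !s) := by
    intro l
    induction l with
    | zero => intro _; exact ⟨k, hk⟩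
    | succ l ih =>
      intro hl
      obtain ⟨k1, hk1⟩ := ih (by omega)
      obtain ⟨k2, s2, hk2⟩ := W.exists_exit hμ i (l + 1 + 1) (val _ (by omega) (by omega))
      have := (W.step hμ i (l + 1) k1 k2 _ s2 (val _ (by omega) (by omega))
        (val _ (by omega) (by omega)) hk1 hk2).2
      refine ⟨k2, ?_⟩
      rw [this] at hk2
      convert hk2 using 1
      rcases Nat.mod_two_eq_zero_or_one l with h0 | h0
      · rw [if_neg (by omega), if_pos (by omega)]
      · rw [if_pos (by omega), if_neg (by omega)]; simp
  refine ⟨s, fun l h1 h2 => ?_⟩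
  obtain ⟨l, rfl⟩ : ∃ r, l = r + 1 := ⟨l - 1, by omega⟩
  obtain ⟨k1, hk1⟩ := key l (by omega)
  obtain ⟨k2, hk2⟩ := key (l + 1) (by omega)
  exact (W.step hμ i (l + 1) k1 k2 _ _ (val _ (by omega) (by omega))
        (val _ (by omega) (by omega)) hk1 hk2).1

/-- Coverage of the edge of type `s`. -/
def Cov (φ : CNF3) (M : Multiset (Sym2 V3)) (s : Bool) (i l : ℕ) : Prop :=
  s(tf s i (6 * l - 3), tf s i (6 * l - 2)) ∈ M ∨
  ∃ j < φ.m, s(tf s i (6 * l - 3), V3.c1 j) ∈ M ∧ s(tf s i (6 * l - 2), V3.c2 j) ∈ M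

lemma cov (W : WalkData φ g N M) (hμ : ∀ i < φ.n, 1 ≤ μ φ i) (i : ℕ) (hi : i < φ.n) :
    ∃ s, (∀ l, 1 ≤ l → l ≤ μ φ i → Cov φ M s i l) ∧ ¬ Cov φ M (!s) i 1 := by
  have hm := hμ i hi
  obtain ⟨s, hs⟩ := W.links hμ i hi
  refine ⟨s, fun l h1 h2 => ?_, ?_⟩
  · have := hs (6 * l - 3) (by omega) (by omega)
    rw [if_pos (by omega)] at this
    rw [Link, show 6 * l - 3 + 1 = 6 * l - 2 by omega] at this
    rcases this with h | ⟨j, hj, -, h⟩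
    · exact Or.inl h
    · exact Or.inr ⟨j, hj, h⟩
  · have := hs 2 (by omega) (by omega)
    rw [if_neg (by omega)] at this
    rcases this with h | ⟨j, hj, h, -⟩
    · rintro (h1 | ⟨j, -, h1, -⟩)
      · have := W.matching _ h _ h1 (tf (!s) i 3) (by simp) (by simp)
        simp at this
      · have := W.matching _ h _ h1 (tf (!s) i 3) (by simp) (by simp)
        simp at this
    · omega

end WalkData

/-- The contribution of an edge to the degree of a vertex. -/
def dl (v : V3) (e : Sym2 V3) : ℕ := if e = Sym2.diag v then 2 else if v ∈ e then 1 else 0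

lemma dl_mk (v x y : V3) :
    dl v s(x, y) = (if x = v then 1 else 0) + (if y = v then 1 else 0) := by
  unfold dl
  by_cases hx : x = v <;> by_cases hy : y = v <;> simp [Sym2.diag, hx, hy, eq_comm]
  all_goals grind

lemma one_le_dl (v : V3) (e : Sym2 V3) (h : v ∈ e) : 1 ≤ dl v e := by
  unfold dl
  split_ifs <;> omega

lemma mDeg_def (M : Multiset (Sym2 V3)) (v : V3) : mDeg M v = (M.map (dl v)).sum := rfl

lemma mDeg_add (A B : Multiset (Sym2 V3)) (v : V3) : mDeg (A + B) v = mDeg A v + mDeg B v := by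
  simp [mDeg_def]

lemma mDeg_mono (A B : Multiset (Sym2 V3)) (h : A ≤ B) (v : V3) : mDeg A v ≤ mDeg B v := by
  obtain ⟨C, rfl⟩ := Multiset.le_iff_exists_add.1 h
  rw [mDeg_add]; omega

lemma sum_dl (S : Finset V3) (e : Sym2 V3) (h : ∀ v ∈ e, v ∈ S) : ∑ v ∈ S, dl v e = 2 := by
  induction e with
  | h x y =>
    simp only [dl_mk, Finset.sum_add_distrib, Finset.sum_ite_eq]
    simp [h]

lemma sum_mDeg (S : Finset V3) (M : Multiset (Sym2 V3)) (h : ∀ e ∈ M, ∀ v ∈ e, v ∈ S) :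
    ∑ v ∈ S, mDeg M v = 2 * Multiset.card M := by
  induction M using Multiset.induction_on with
  | empty => simp [mDeg_def]
  | cons e M ih =>
    have h1 := ih (fun e' he' => h e' (Multiset.mem_cons_of_mem he'))
    have h2 := sum_dl S e (h e (Multiset.mem_cons_self e M))
    simp only [mDeg_def, Multiset.map_cons, Multiset.sum_cons, Finset.sum_add_distrib,
      Multiset.card_cons] at h1 ⊢
    omega

lemma mDeg_finset (S : Finset (Sym2 V3)) (v : V3) (h : Sym2.diag v ∉ S) :
    mDeg S.val v = (S.filter (fun e => v ∈ e)).card := by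
  rw [Finset.card_filter]
  change ∑ e ∈ S, dl v e = _
  apply Finset.sum_congr rfl
  intro e he
  have : e ≠ Sym2.diag v := by rintro rfl; exact h he
  simp [dl, this]

lemma even_pair (S : Finset (Sym2 V3)) (v : V3) (h : Sym2.diag v ∉ S)
    (H : ∀ e ∈ S, v ∈ e → ∃ e1 e2, e1 ≠ e2 ∧ e1 ∈ S ∧ e2 ∈ S ∧ v ∈ e1 ∧ v ∈ e2 ∧
      ∀ e ∈ S, v ∈ e → e = e1 ∨ e = e2) : Even (mDeg S.val v) := by
  rw [mDeg_finset S v h]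
  rcases (S.filter (fun e => v ∈ e)).eq_empty_or_nonempty with h0 | ⟨e, he⟩
  · simp [h0]
  · rw [Finset.mem_filter] at he
    obtain ⟨e1, e2, hne, h1, h2, h3, h4, h5⟩ := H e he.1 he.2
    have : S.filter (fun e => v ∈ e) = {e1, e2} := by
      ext e
      simp only [Finset.mem_filter, Finset.mem_insert, Finset.mem_singleton]
      constructor
      · rintro ⟨a, b⟩; exact h5 e a b
      · rintro (rfl | rfl) <;> constructor <;> assumption
    rw [this, Finset.card_pair hne]
    exact even_two

lemma even_z (φ : CNF3) (hμ : ∀ i < φ.n, 1 ≤ μ φ i) (i l : ℕ) :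
    Even (mDeg (Eall φ).val (V3.z i l)) := by
  apply even_pair
  · intro h
    obtain ⟨-, s, hs⟩ := adj_z φ hμ i l _ h
    simp at hs
  · intro e he hz
    obtain ⟨y, rfl⟩ := hz
    obtain ⟨hv, -⟩ := adj_z φ hμ i l _ he
    refine ⟨s(tf true i l, V3.z i l), s(tf false i l, V3.z i l), by simp,
      (mem_Eall _ _).2 (Or.inr (Or.inr ⟨true, i, l, hv, rfl⟩)),
      (mem_Eall _ _).2 (Or.inr (Or.inr ⟨false, i, l, hv, rfl⟩)), by simp, by simp, ?_⟩
    intro e he hz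
    obtain ⟨y, rfl⟩ := hz
    obtain ⟨-, s, rfl⟩ := adj_z φ hμ i l _ he
    cases s <;> simp

lemma even_a (φ : CNF3) (hμ : ∀ i < φ.n, 1 ≤ μ φ i) (i j : ℕ) :
    Even (mDeg (Eall φ).val (V3.a i j)) := by
  apply even_pair
  · intro h
    obtain ⟨-, hs⟩ := adj_a φ hμ i j _ h (by simp [Sym2.diag])
    simp [Sym2.diag] at hs
  · intro e he hz
    obtain ⟨⟨s, hj, hc⟩, -⟩ := adj_a φ hμ i j e he hz
    have key : ∀ e ∈ ZZ φ s i j, e ∈ Eall φ := fun e he =>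
      (mem_Eall _ _).2 (Or.inl (mem_E0_ZZ φ s i j hj hc e he))
    exact ⟨s(V3.c1 j, V3.a i j), s(V3.a i j, V3.c2 j), by simp,
      key _ (by simp [ZZ]), key _ (by simp [ZZ]), by simp, by simp,
      fun e he hz => (adj_a φ hμ i j e he hz).2⟩

lemma even_b (φ : CNF3) (hμ : ∀ i < φ.n, 1 ≤ μ φ i) (i j : ℕ) :
    Even (mDeg (Eall φ).val (V3.b i j)) := by
  apply even_pair
  · intro h
    obtain ⟨s, -, -, hs⟩ := adj_b φ hμ i j _ h (by simp [Sym2.diag])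
    simp [Sym2.diag] at hs
  · intro e he hz
    obtain ⟨s, hj, hc, -⟩ := adj_b φ hμ i j e he hz
    have hp := (posOf_pos φ i j s hj hc).2
    have key : ∀ e ∈ ZZ φ s i j, e ∈ Eall φ := fun e he =>
      (mem_Eall _ _).2 (Or.inl (mem_E0_ZZ φ s i j hj hc e he))
    refine ⟨s(tf s i (6 * posOf φ i j - 2), V3.b i j), s(V3.b i j, tf s i (6 * posOf φ i j - 3)),
      by simp; omega, key _ (by simp [ZZ]), key _ (by simp [ZZ]), by simp, by simp, ?_⟩
    intro e he hz
    obtain ⟨s', -, hc', h⟩ := adj_b φ hμ i j e he hz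
    have : s' = s := by
      have := φ.no_taut j hj i
      cases s <;> cases s' <;> simp_all
    subst this
    exact h

lemma even_cs (φ : CNF3) (hμ : ∀ i < φ.n, 1 ≤ μ φ i) :
    Even (mDeg (Eall φ).val V3.cs) := by
  rw [mDeg_finset]
  · have : (Eall φ).filter (fun e => V3.cs ∈ e) =
        (Finset.range φ.m).image (fun j => s(V3.cs, V3.c1 j)) ∪
        (Finset.range φ.m).image (fun j => s(V3.cs, V3.c2 j)) := by
      ext e
      simp only [Finset.mem_filter, Finset.mem_union, Finset.mem_image, Finset.mem_range]
      constructor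
      · rintro ⟨he, y, rfl⟩
        obtain ⟨j, hj, rfl | rfl⟩ := adj_cs φ hμ _ he
        · exact Or.inl ⟨j, hj, rfl⟩
        · exact Or.inr ⟨j, hj, rfl⟩
      · rintro (⟨j, hj, rfl⟩ | ⟨j, hj, rfl⟩)
        · exact ⟨(mem_Eall _ _).2 (Or.inr (Or.inl ⟨j, hj, Or.inl Sym2.eq_swap⟩)), by simp⟩
        · exact ⟨(mem_Eall _ _).2 (Or.inr (Or.inl ⟨j, hj, Or.inr rfl⟩)), by simp⟩
    rw [this, Finset.card_union_of_disjoint, Finset.card_image_of_injective,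
      Finset.card_image_of_injective]
    · exact ⟨_, rfl⟩
    · intro x y h; simpa using h
    · intro x y h; simpa using h
    · rw [Finset.disjoint_left]
      intro e h1 h2
      simp only [Finset.mem_image, Finset.mem_range] at h1 h2
      obtain ⟨j, -, rfl⟩ := h1
      obtain ⟨j', -, h⟩ := h2
      simp at h
  · intro h
    obtain ⟨j, -, hs⟩ := adj_cs φ hμ _ h
    simp at hs

lemma walkEdgeList_eq (T : List V3) : walkEdgeList T = (List.range (T.length - 1)).map
    (fun k => s(T.getD k V3.cs, T.getD (k + 1) V3.cs)) := by
  apply List.ext_getElem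
  · simp [walkEdgeList]
  · intro k h1 h2
    simp at h2
    simp [walkEdgeList]
    rw [List.getElem?_eq_getElem (by omega), List.getElem?_eq_getElem (by omega)]
    simp

lemma even_walk (g : ℕ → V3) (N : ℕ) (h : g 0 = g N) (v : V3) :
    Even (mDeg ((Finset.range N).val.map (fun k => s(g k, g (k + 1)))) v) := by
  rw [mDeg_def, Multiset.map_map]
  change Even (∑ k ∈ Finset.range N, dl v s(g k, g (k + 1)))
  simp only [dl_mk, Finset.sum_add_distrib]
  have h1 := Finset.sum_range_succ (fun k => if g k = v then 1 else 0) N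
  have h2 := Finset.sum_range_succ' (fun k => if g k = v then 1 else 0) N
  simp only [h] at h1 h2
  refine ⟨∑ k ∈ Finset.range N, if g k = v then 1 else 0, ?_⟩
  omega

lemma deg_le (φ : CNF3) (W M : Multiset (Sym2 V3)) (hW : W = (Eall φ).val + M)
    (hsub : ∀ e ∈ M, e ∈ Eall φ) (hev : ∀ v, Even (mDeg W v))
    (hc : (Multiset.card W : ℚ) ≤ (Eall φ).card + (imb φ : ℚ) / 2) (v : V3) :
    mDeg M v ≤ 1 ∧ (Even (mDeg (Eall φ).val v) → mDeg M v = 0) := by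
  classical
  set S : Finset V3 := (Eall φ).biUnion Sym2.toFinset with hS
  have hSmem : ∀ e ∈ Eall φ, ∀ v ∈ e, v ∈ S := by
    intro e he v hv
    simp only [hS, Finset.mem_biUnion, Sym2.mem_toFinset]
    exact ⟨e, he, hv⟩
  have hzero : ∀ A : Multiset (Sym2 V3), (∀ e ∈ A, e ∈ Eall φ) → ∀ v ∉ S, mDeg A v = 0 := by
    intro A hA v hv
    rw [mDeg_def, Multiset.sum_eq_zero]
    intro x hx
    obtain ⟨e, he, rfl⟩ := Multiset.mem_map.1 hx
    have : v ∉ e := fun h => hv (hSmem e (hA e he) v h)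
    have h2 : e ≠ Sym2.diag v := by rintro rfl; simp [Sym2.diag] at this
    simp [dl, this, h2]
  set o : V3 → ℕ := fun v => if Even (mDeg (Eall φ).val v) then 0 else 1 with ho
  have himb : imb φ = ∑ v ∈ S, o v := by
    have : imb φ = (S.filter (fun v => ¬ Even (mDeg (Eall φ).val v))).card := by
      unfold imb
      apply Nat.subtype_card
      intro v
      simp only [Finset.mem_filter, and_iff_right_iff_imp]
      intro hv
      by_contra hS'
      exact hv (by simp [hzero (Eall φ).val (fun e he => he) v hS'])
    rw [this, Finset.card_filter]
    apply Finset.sum_congr rfl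
    intro v _
    by_cases hv : Even (mDeg (Eall φ).val v) <;> simp [ho, hv]
  have hpar : ∀ v, o v ≤ mDeg M v := by
    intro v
    have h1 := hev v
    rw [hW, mDeg_add, Nat.even_add] at h1
    by_cases hv : Even (mDeg (Eall φ).val v)
    · simp [ho, hv]
    · have : ¬ Even (mDeg M v) := by tauto
      have h0 : mDeg M v ≠ 0 := by intro h0; simp [h0] at this
      simp [ho, hv]; omega
  have hsum := sum_mDeg S M (fun e he => hSmem e (hsub e he))
  have hle : 2 * Multiset.card M ≤ imb φ := by
    rw [hW, Multiset.card_add, Finset.card_val] at hc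
    push_cast at hc
    have : (2 * (Multiset.card M : ℚ)) ≤ imb φ := by linarith
    exact_mod_cast this
  have heq : ∀ v ∈ S, o v = mDeg M v := by
    apply (Finset.sum_eq_sum_iff_of_le (fun v _ => hpar v)).1
    apply le_antisymm (Finset.sum_le_sum (fun v _ => hpar v))
    omega
  by_cases hv : v ∈ S
  · rw [← heq v hv]
    by_cases hv : Even (mDeg (Eall φ).val v) <;> simp [ho, hv]
  · simp [hzero M hsub v hv]

lemma walkData (φ : CNF3) (hμ : ∀ i < φ.n, 1 ≤ μ φ i) (T : List V3) (hT : IsTightTour φ T)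
    (M : Multiset (Sym2 V3)) (hM : M = walkEdges T - (Eall φ).val) :
    ∃ g N, WalkData φ g N M := by
  obtain ⟨⟨hne, hch, hcl, hall, hprec⟩, hc⟩ := hT
  have hlen : 0 < T.length := List.length_pos_iff.2 hne
  set N := T.length - 1 with hN
  set g : ℕ → V3 := fun k => T.getD k V3.cs with hg
  set ed : ℕ → Sym2 V3 := fun k => s(g k, g (k + 1)) with hed
  have hL : walkEdgeList T = (List.range N).map ed := walkEdgeList_eq T
  have hW : walkEdges T = (Finset.range N).val.map ed := by
    rw [walkEdges, hL]; rfl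
  have hclosed : g 0 = g N := by
    rw [List.head?_eq_getElem?, List.getLast?_eq_getElem?] at hcl
    simp only [hg, List.getD_eq_getElem?_getD, hcl, hN]
  have hedge : ∀ k < N, ed k ∈ Eall φ := by
    intro k hk
    have := (List.isChain_iff_getElem.1 hch) k (by omega)
    simp only [hed, hg, List.getD_eq_getElem?_getD]
    rw [List.getElem?_eq_getElem (by omega), List.getElem?_eq_getElem (by omega)]
    exact this
  have hmemW : ∀ e ∈ walkEdges T, ∃ k < N, ed k = e := by
    intro e he
    rw [hW] at he
    obtain ⟨k, hk, rfl⟩ := Multiset.mem_map.1 he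
    exact ⟨k, by simpa using hk, rfl⟩
  have hle : (Eall φ).val ≤ walkEdges T :=
    (Multiset.le_iff_subset (Eall φ).nodup).2 (fun e he => hall e he)
  have hWM : walkEdges T = (Eall φ).val + M := by
    rw [hM, add_tsub_cancel_of_le hle]
  have hsub : ∀ e ∈ M, e ∈ Eall φ := by
    intro e he
    obtain ⟨k, hk, rfl⟩ := hmemW e (by rw [hWM]; exact Multiset.mem_add.2 (Or.inr he))
    exact hedge k hk
  have hdeg := deg_le φ (walkEdges T) M hWM hsub
    (fun v => by rw [hW]; exact even_walk g N hclosed v) hc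
  have hcount : ∀ e, (walkEdges T).count e ≤ M.count e + 1 := by
    intro e
    rw [hWM, Multiset.count_add]
    have := Multiset.nodup_iff_count_le_one.1 (Eall φ).nodup e
    omega
  have hcard : ∀ (s : Finset ℕ) e, (∀ k ∈ s, k < N ∧ ed k = e) → s.card ≤ (walkEdges T).count e := by
    intro s e hs
    rw [hW, Multiset.count_map]
    change s.card ≤ ((Finset.range N).filter (fun k => e = ed k)).card
    apply Finset.card_le_card
    intro k hk
    simp only [Finset.mem_filter, Finset.mem_range]
    exact ⟨(hs k hk).1, (hs k hk).2.symm⟩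
  have hpair : ∀ e e' v, v ∈ e → v ∈ e' → ({e, e'} : Multiset (Sym2 V3)) ≤ M → False := by
    intro e e' v h1 h2 h3
    have h4 := mDeg_mono _ _ h3 v
    have h5 := (hdeg v).1
    have h6 := one_le_dl v e h1
    have h7 := one_le_dl v e' h2
    simp only [mDeg_def, Multiset.insert_eq_cons, Multiset.map_cons, Multiset.map_singleton,
      Multiset.sum_cons, Multiset.sum_singleton] at h4 h5
    omega
  have heven : ∀ v, Even (mDeg (Eall φ).val v) → ∀ e ∈ M, v ∉ e := by
    intro v hv e he hve
    have h1 := (hdeg v).2 hv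
    have h2 := mDeg_mono {e} M (by simpa using he) v
    have h3 := one_le_dl v e hve
    simp only [mDeg_def, Multiset.map_singleton, Multiset.sum_singleton] at h1 h2
    omega
  refine ⟨g, N, ⟨hedge, ?_, ?_, hclosed, ?_, ?_, ?_, ?_, ?_, ?_, ?_⟩⟩
  · intro q hq A hA hmem B hB hBA e he
    have hget : ∀ k (hk : k < (walkEdgeList T).length), (walkEdgeList T).get ⟨k, hk⟩ = ed k := by
      intro k hk
      simp [hL]
    have hlenL : (walkEdgeList T).length = N := by simp [hL]
    obtain ⟨p, hp, hpq, hpe⟩ := hprec q (by omega) A hA (by rw [hget]; exact hmem) B hB hBA e he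
    rw [hget] at hpe
    exact ⟨p, hpq, hpe⟩
  · intro e he
    exact hmemW e (hall e he)
  · intro p q hpq hq h
    have h1 := hcard {p, q} (ed q) (by
      intro k hk
      simp only [Finset.mem_insert, Finset.mem_singleton] at hk
      rcases hk with rfl | rfl
      · exact ⟨by omega, h⟩
      · exact ⟨by omega, rfl⟩)
    rw [Finset.card_pair (by omega)] at h1
    have h2 := hcount (ed q)
    exact Multiset.count_pos.1 (by omega : 0 < M.count (ed q))
  · intro p q r hpq hqr hr h1 h2
    have h3 := hcard {p, q, r} (ed r) (by
      intro k hk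
      simp only [Finset.mem_insert, Finset.mem_singleton] at hk
      rcases hk with rfl | rfl | rfl
      · exact ⟨by omega, h1⟩
      · exact ⟨by omega, h2⟩
      · exact ⟨by omega, rfl⟩)
    rw [Finset.card_eq_three.2 ⟨p, q, r, by omega, by omega, by omega, rfl⟩] at h3
    have h4 := hcount (ed r)
    have h5 : Multiset.replicate 2 (ed r) ≤ M := Multiset.le_count_iff_replicate_le.1 (by omega)
    exact hpair (ed r) (ed r) (g r) (by simp [hed]) (by simp [hed]) h5
  · intro e he e' he' v hv hv'
    by_contra hne
    refine hpair e e' v hv hv' ?_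
    refine (Multiset.le_iff_subset (by simp [hne])).2 ?_
    intro x hx
    simp only [Multiset.insert_eq_cons, Multiset.mem_cons, Multiset.mem_singleton] at hx
    rcases hx with rfl | rfl <;> assumption
  · intro e he i l; exact heven _ (even_z φ hμ i l) e he
  · intro e he; exact heven _ (even_cs φ hμ) e he
  · intro e he i l; exact heven _ (even_a φ hμ i l) e he
  · intro e he i l; exact heven _ (even_b φ hμ i l) e he


/-- Let `T` be a tight tour for the HCPP instance `I_φ` produced by the construction
from a 3-CNF formula `φ` (in which every variable occurs in some clause), and let
`M = E(T) \ E`. Then for each variable index `i`, either the edge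
`{t_i^{6ℓ−3}, t_i^{6ℓ−2}}` is covered for all `ℓ ∈ {1,…,μ_i}`, or the edge
`{f_i^{6ℓ−3}, f_i^{6ℓ−2}}` is covered for all `ℓ ∈ {1,…,μ_i}` — and not both. -/
theorem tight_tour_covering (φ : CNF3) (hμ : ∀ i < φ.n, 1 ≤ μ φ i)
    (T : List V3) (hT : IsTightTour φ T)
    (M : Multiset (Sym2 V3)) (hM : M = walkEdges T - (Eall φ).val) :
    ∀ i < φ.n,
      Xor' (∀ l : ℕ, 1 ≤ l → l ≤ μ φ i → coveredT φ M i l)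
           (∀ l : ℕ, 1 ≤ l → l ≤ μ φ i → coveredF φ M i l) := by
  intro i hi
  obtain ⟨g, N, W⟩ := walkData φ hμ T hT M hM
  obtain ⟨s, h1, h2⟩ := W.cov hμ i hi
  cases s
  · exact Or.inr ⟨h1, fun h => h2 (h 1 le_rfl (hμ i hi))⟩
  · exact Or.inl ⟨h1, fun h => h2 (h 1 le_rfl (hμ i hi))⟩


end HCPPFormal
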